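/- arXiv:math/0608264 — 2 statements merged into one kernel-verified Lean document; each statement's English description precedes it below -/
import Mathlib

section
/- For every vertex a₁, the fan set T(a₁) is a triangulation of the punctured polygon: its elements are pairwise non-crossing, it has exactly n elements, and it is a maximal pairwise non-crossing set of tagged edges. -/
/-- The number of vertices `|δ_{a,b}|` on the counterclockwise boundary path from `a` to `b`
(including both endpoints); `|δ_{a,a}| = n + 1`. -/
def deltaLen {n : ℕ} (a b : ZMod n) : ℕ :=
  if a = b then n + 1 else (b - a).val + 1

/-- A tagged edge `M_{a,b}^ε` of the punctured polygon with `n` vertices: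
`a, b` are vertices with `|δ_{a,b}| ≥ 3`, `ε ∈ {+1, -1}` (an element of `ℤˣ`),
and `ε = 1` whenever `a ≠ b`. -/
structure TaggedEdge (n : ℕ) where
  a : ZMod n
  b : ZMod n
  ε : ℤˣ
  tag_eq_one : a ≠ b → ε = 1
  three_le : 3 ≤ deltaLen a b

/-- The translation `τ`: `τ M_{a,b} = M_{a-1,b-1}` for `a ≠ b`, and
`τ M_{a,a}^ε = M_{a-1,a-1}^{-ε}`. -/
def tau {n : ℕ} (M : TaggedEdge n) : TaggedEdge n where
  a := M.a - 1
  b := M.b - 1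
  ε := if M.a = M.b then -M.ε else M.ε
  tag_eq_one := by
    intro h
    have hab : M.a ≠ M.b := by
      intro he; exact h (by rw [he])
    rw [if_neg hab]
    exact M.tag_eq_one hab
  three_le := by
    by_cases hab : M.a = M.b
    · have h1 : M.a - 1 = M.b - 1 := by rw [hab]
      have h3 := M.three_le
      unfold deltaLen at h3 ⊢
      rw [if_pos h1]
      rwa [if_pos hab] at h3
    · have h1 : M.a - 1 ≠ M.b - 1 := by
        intro he
        apply hab
        have h2 := congrArg (fun x => x + 1) he
        simpa using h2
      have h2 : M.b - 1 - (M.a - 1) = M.b - M.a := by ring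
      have h3 := M.three_le
      unfold deltaLen at h3 ⊢
      rw [if_neg h1, h2]
      rwa [if_neg hab] at h3

/-- The loop tagged edge `M_{a,a}^{-ε}` obtained from a loop `M_{a,a}^ε` by changing the tag. -/
def negLoop {n : ℕ} (M : TaggedEdge n) (h : M.a = M.b) : TaggedEdge n where
  a := M.a
  b := M.b
  ε := -M.ε
  tag_eq_one := fun hab => absurd h hab
  three_le := M.three_le

/-- `x` lies on the closed counterclockwise boundary interval `[u,v]`. -/
def memCC {n : ℕ} (x u v : ZMod n) : Prop := (x - u).val ≤ (v - u).val

/-- `x` lies on the open counterclockwise boundary interval `]u,v[`. -/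
def memOO {n : ℕ} (x u v : ZMod n) : Prop := memCC x u v ∧ x ≠ u ∧ x ≠ v

open Classical in
/-- The crossing number `e(M,N)` of two tagged edges. -/
noncomputable def crossNum {n : ℕ} (M N : TaggedEdge n) : ℕ :=
  if M.a = M.b then
    (if N.a = N.b then
      (if M.a ≠ N.a ∧ M.ε ≠ N.ε then 1 else 0)
    else
      (if memOO M.a N.a N.b then 1 else 0))
  else
    (if N.a = N.b then
      (if memOO N.a M.a M.b then 1 else 0)
    else
      (if memOO N.a (M.a + 1) M.b ∧ memOO N.b M.a N.a then 2
       else if (memCC N.a (M.a + 1) (M.b - 1) ∧ memCC N.b (M.b + 1) M.a) ∨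
               (memCC N.a M.b (M.a - 1) ∧ memCC N.b (M.a + 1) (M.b - 1)) then 1
       else 0))

/-- There is an elementary move `M ↦ N`. -/
def Move {n : ℕ} (M N : TaggedEdge n) : Prop :=
  (M.a ≠ M.b ∧ 3 ≤ deltaLen M.a M.b ∧ deltaLen M.a M.b ≤ n - 1 ∧
    N.a = M.a ∧ N.b = M.b + 1) ∨
  (M.a ≠ M.b ∧ 4 ≤ deltaLen M.a M.b ∧ deltaLen M.a M.b ≤ n ∧
    N.a = M.a + 1 ∧ N.b = M.b) ∨
  (M.a ≠ M.b ∧ deltaLen M.a M.b = n ∧ N.a = M.a ∧ N.b = M.a) ∨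
  (M.a = M.b ∧ N.a = M.a + 1 ∧ N.b = M.a)

/-- A triangulation: a maximal set of pairwise non-crossing tagged edges. -/
def IsTriangulation {n : ℕ} (T : Set (TaggedEdge n)) : Prop :=
  (∀ M ∈ T, ∀ N ∈ T, crossNum M N = 0) ∧
  (∀ T' : Set (TaggedEdge n), (∀ M ∈ T', ∀ N ∈ T', crossNum M N = 0) → T ⊆ T' → T' = T)

/-- The fan triangulation `T(a₁) = {M_{a₁,a₁}^{+1}, M_{a₁,a₁}^{-1}} ∪
{M_{a₁, a₁+k-1} : 3 ≤ k ≤ n}`. -/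
def fan {n : ℕ} (a₁ : ZMod n) : Set (TaggedEdge n) :=
  {M | M.a = a₁ ∧ (M.b = a₁ ∨ ∃ k : ℕ, 3 ≤ k ∧ k ≤ n ∧ M.b = a₁ + (k : ZMod n) - 1)}

open Classical in
/-- The translation `τ_Γ` of the translation quiver `Γ`. -/
noncomputable def tauGamma {n : ℕ} (a₁ : ZMod n) (v : ℤ × TaggedEdge n) :
    ℤ × TaggedEdge n :=
  if v.2 ∈ fan a₁ then (v.1 - 1, tau v.2) else (v.1, tau v.2)

/-- The arrows of the quiver `Γ` with vertex set `ℤ × (tagged edges)`. -/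
def GammaArrow {n : ℕ} (a₁ : ZMod n) (v w : ℤ × TaggedEdge n) : Prop :=
  (Move v.2 w.2 ∧ (w.2 ∉ fan a₁ ∨ (v.2 ∈ fan a₁ ∧ w.2 ∈ fan a₁)) ∧ w.1 = v.1) ∨
  (Move v.2 w.2 ∧ w.2 ∈ fan a₁ ∧ v.2 ∉ fan a₁ ∧ w.1 = v.1 + 1)

lemma deltaLen_of_ne {n : ℕ} {a b : ZMod n} (h : a ≠ b) : deltaLen a b = (b - a).val + 1 :=
  if_neg h

lemma deltaLen_self {n : ℕ} (a : ZMod n) : deltaLen a a = n + 1 :=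
  if_pos rfl

lemma ZMod.val_two_of_three_le {n : ℕ} (hn : 3 ≤ n) : (2 : ZMod n).val = 2 := by
  simpa using ZMod.val_natCast_of_lt (n := n) (a := 2) (by omega)

lemma ZMod.val_sub_one_lt {n : ℕ} [NeZero n] {u : ZMod n} (hu : u ≠ 0) :
    (u - 1).val < u.val := by
  have hpos : 0 < u.val := Nat.pos_of_ne_zero (by simpa using hu)
  have hlt := u.val_lt
  have hone : (1 : ZMod n).val = 1 := by
    simpa using ZMod.val_natCast_of_lt (n := n) (a := 1) (by omega)
  rw [ZMod.val_sub (by omega), hone]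
  omega

lemma not_memCC_add_one {n : ℕ} [NeZero n] {a v : ZMod n} (hv : v ≠ a) :
    ¬ memCC a (a + 1) v := by
  intro h
  have h1 := ZMod.val_sub_one_lt (sub_ne_zero.mpr hv)
  unfold memCC at h
  rw [show a - (a + 1) = (-1 : ZMod n) by ring, show v - (a + 1) = v - a - 1 by ring] at h
  have hlt := (v - a).val_lt
  obtain ⟨m, rfl⟩ := Nat.exists_eq_succ_of_ne_zero (NeZero.ne n)
  rw [ZMod.val_neg_one] at h
  omega

lemma not_memCC_sub_one {n : ℕ} [NeZero n] {a u : ZMod n} (hu : u ≠ a) :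
    ¬ memCC a u (a - 1) := by
  have h := ZMod.val_sub_one_lt (sub_ne_zero.mpr hu.symm)
  unfold memCC
  rw [show a - 1 - u = a - u - 1 by ring]
  omega

lemma TaggedEdge.ext_of_ne {n : ℕ} {M N : TaggedEdge n} (ha : M.a = N.a) (hb : M.b = N.b)
    (hε : M.a = M.b → M.ε = N.ε) : M = N := by
  obtain ⟨a, b, ε, h, _⟩ := M
  obtain ⟨a', b', ε', h', _⟩ := N
  obtain rfl : a = a' := ha
  obtain rfl : b = b' := hb
  by_cases hab : a = b
  · obtain rfl : ε = ε' := hε hab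
    rfl
  · obtain rfl := h hab
    obtain rfl := h' hab
    rfl

/-- The loop tagged edge `M_{a,a}^ε`. -/
def loopEdge {n : ℕ} (hn : 3 ≤ n) (a : ZMod n) (ε : ℤˣ) : TaggedEdge n where
  a := a
  b := a
  ε := ε
  tag_eq_one := fun h => absurd rfl h
  three_le := by rw [deltaLen_self]; omega

lemma three_le_deltaLen {n : ℕ} (hn : 3 ≤ n) {a b : ZMod n} (h : b ≠ a + 1) :
    3 ≤ deltaLen a b := by
  by_cases hab : a = b
  · rw [hab, deltaLen_self]
    omega
  · have : NeZero n := ⟨by omega⟩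
    rw [deltaLen_of_ne hab]
    have h0 : (b - a).val ≠ 0 := by
      rw [Ne, ZMod.val_eq_zero, sub_eq_zero]
      exact Ne.symm hab
    have h1 : (b - a).val ≠ 1 := by
      intro h1
      apply h
      have h2 := ZMod.natCast_zmod_val (b - a)
      rw [h1, Nat.cast_one] at h2
      rw [h2]
      ring
    omega

/-- The tagged edge `M_{a,b}` with tag `+1`. -/
def plainEdge {n : ℕ} (hn : 3 ≤ n) (a b : ZMod n) (h : b ≠ a + 1) : TaggedEdge n where
  a := a
  b := b
  ε := 1
  tag_eq_one := fun _ => rfl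
  three_le := three_le_deltaLen hn h

lemma TaggedEdge.b_ne_add_one {n : ℕ} (hn : 3 ≤ n) (M : TaggedEdge n) : M.b ≠ M.a + 1 := by
  intro h
  have : Fact (1 < n) := ⟨by omega⟩
  have h3 := M.three_le
  rw [h, deltaLen_of_ne (by simp), add_sub_cancel_left, ZMod.val_one] at h3
  omega

lemma mem_fan_iff {n : ℕ} (hn : 3 ≤ n) {a₁ : ZMod n} {M : TaggedEdge n} :
    M ∈ fan a₁ ↔ M.a = a₁ := by
  refine ⟨fun h => h.1, fun h => ⟨h, ?_⟩⟩
  have : NeZero n := ⟨by omega⟩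
  subst h
  by_cases hab : M.a = M.b
  · exact Or.inl hab.symm
  · have h3 := M.three_le
    rw [deltaLen_of_ne hab] at h3
    refine Or.inr ⟨(M.b - M.a).val + 1, h3, (M.b - M.a).val_lt, ?_⟩
    push_cast
    rw [ZMod.natCast_zmod_val]
    ring

lemma crossNum_eq_zero_of_a_eq {n : ℕ} [NeZero n] {M N : TaggedEdge n} (h : M.a = N.a) :
    crossNum M N = 0 := by
  unfold crossNum
  rw [← h]
  split_ifs with hM hN h1 h2 h3 h4 h5 h6
  · exact absurd rfl h1.1
  · rfl
  · exact absurd rfl h2.2.1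
  · rfl
  · exact absurd rfl h4.2.1
  · rfl
  · exact absurd h5.1.1 (not_memCC_add_one (Ne.symm hM))
  · rcases h6 with h6 | h6
    · by_cases hb : M.b - 1 = M.a
      · have hlen := M.three_le
        rw [deltaLen_of_ne hM, show M.b - M.a = 1 by rw [← hb]; ring] at hlen
        have := ZMod.val_one_eq_one_mod n
        have := Nat.mod_le 1 n
        omega
      · exact absurd h6.1 (not_memCC_add_one hb)
    · exact absurd h6.1 (not_memCC_sub_one (Ne.symm hM))
  · rfl

lemma exists_mem_fan_crossNum_ne_zero {n : ℕ} (hn : 3 ≤ n) {a₁ : ZMod n} {N : TaggedEdge n}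
    (hN : N.a ≠ a₁) : ∃ M ∈ fan a₁, crossNum M N ≠ 0 := by
  have : NeZero n := ⟨by omega⟩
  by_cases hl : N.a = N.b
  · refine ⟨loopEdge hn a₁ (-N.ε), (mem_fan_iff hn).2 rfl, ?_⟩
    have hε : -N.ε ≠ N.ε := by
      rcases Int.units_eq_one_or N.ε with h | h <;> rw [h] <;> decide
    simp [crossNum, loopEdge, hl, hε, show a₁ ≠ N.b from fun h => hN (hl.trans h.symm)]
  by_cases hm : memOO a₁ N.a N.b
  · refine ⟨loopEdge hn a₁ 1, (mem_fan_iff hn).2 rfl, ?_⟩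
    simp [crossNum, loopEdge, hl, hm]
  have hd : 2 ≤ (N.b - N.a).val := by
    have h3 := N.three_le
    rw [deltaLen_of_ne hl] at h3
    omega
  have hle : (N.b - N.a).val ≤ (a₁ - N.a).val := by
    by_contra hlt
    refine hm ⟨by unfold memCC; omega, hN.symm, ?_⟩
    rintro rfl
    exact hlt le_rfl
  have h2 := ZMod.val_two_of_three_le hn
  have hne : a₁ ≠ N.a + 1 := by
    rintro rfl
    have : Fact (1 < n) := ⟨by omega⟩
    rw [add_sub_cancel_left, ZMod.val_one] at hle
    omega
  refine ⟨plainEdge hn a₁ (N.a + 1) (by simpa using hN), (mem_fan_iff hn).2 rfl, ?_⟩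
  have h1 : memCC N.a (a₁ + 1) (N.a + 1 - 1) := by
    unfold memCC
    rw [add_sub_cancel_right]
  have h4 : memCC N.b (N.a + 1 + 1) a₁ := by
    unfold memCC
    rw [show N.b - (N.a + 1 + 1) = N.b - N.a - 2 by ring,
      show a₁ - (N.a + 1 + 1) = a₁ - N.a - 2 by ring,
      ZMod.val_sub (a := N.b - N.a) (by omega), ZMod.val_sub (a := a₁ - N.a) (by omega)]
    omega
  unfold crossNum plainEdge
  rw [if_neg hne, if_neg hl]
  split_ifs with h5 h6
  · decide
  · decide
  · exact absurd (Or.inl ⟨h1, h4⟩) h6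

open Classical in
/-- The vertex parametrizing a fan edge: the end point for edges with tag `+1`, and the
neighbor `a + 1`, which ends no edge starting at `a`, for the loop with tag `-1`. -/
noncomputable def fanVertex {n : ℕ} (M : TaggedEdge n) : ZMod n :=
  if M.ε = 1 then M.b else M.a + 1

lemma fanVertex_bijOn {n : ℕ} (hn : 3 ≤ n) (a₁ : ZMod n) :
    Set.BijOn fanVertex (fan a₁) Set.univ := by
  refine ⟨fun _ _ => Set.mem_univ _, fun M hM N hN h => ?_, fun x _ => ?_⟩
  · rw [mem_fan_iff hn] at hM hN
    have hMN : M.a = N.a := hM.trans hN.symm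
    have hMb := M.b_ne_add_one hn
    have hNb := N.b_ne_add_one hn
    unfold fanVertex at h
    split_ifs at h with h1 h2 h2
    · exact TaggedEdge.ext_of_ne hMN h fun _ => h1.trans h2.symm
    · exact absurd (h.trans (by rw [hMN])) hMb
    · exact absurd (h.symm.trans (by rw [hMN])) hNb
    · have hMl : M.a = M.b := not_not.1 (mt M.tag_eq_one h1)
      have hNl : N.a = N.b := not_not.1 (mt N.tag_eq_one h2)
      refine TaggedEdge.ext_of_ne hMN (hMl.symm.trans (hMN.trans hNl)) fun _ => ?_
      exact ((Int.units_eq_one_or _).resolve_left h1).trans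
        ((Int.units_eq_one_or _).resolve_left h2).symm
  · by_cases hx : x = a₁ + 1
    · refine ⟨loopEdge hn a₁ (-1), (mem_fan_iff hn).2 rfl, ?_⟩
      unfold fanVertex loopEdge
      rw [if_neg (show (-1 : ℤˣ) ≠ 1 by decide), hx]
    · exact ⟨plainEdge hn a₁ x hx, (mem_fan_iff hn).2 rfl, if_pos rfl⟩

/-- For every vertex `a₁`, the fan set `T(a₁)` is a triangulation of the punctured
polygon (a maximal pairwise non-crossing set of tagged edges) and has exactly `n` elements. -/
theorem fan_isTriangulation (n : ℕ) (hn : 3 ≤ n) (a₁ : ZMod n) :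
    IsTriangulation (fan a₁) ∧ (fan a₁).ncard = n := by
  have : NeZero n := ⟨by omega⟩
  refine ⟨⟨fun M hM N hN => ?_, fun T' hT' hsub => ?_⟩, ?_⟩
  · rw [mem_fan_iff hn] at hM hN
    exact crossNum_eq_zero_of_a_eq (hM.trans hN.symm)
  · refine Set.Subset.antisymm (fun N hN => ?_) hsub
    rw [mem_fan_iff hn]
    by_contra hNa
    obtain ⟨M, hM, hMN⟩ := exists_mem_fan_crossNum_ne_zero hn hNa
    exact hMN (hT' M (hsub hM) N hN)
  · have hb := fanVertex_bijOn hn a₁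
    rw [← hb.injOn.ncard_image, hb.image_eq, Set.ncard_univ, Nat.card_zmod]
end

section
/- For all tagged edges M and N, e(M,N) = e(N,M), i.e. the crossing number is symmetric. -/
/-- Counterclockwise distances can be computed from the distances to a base point. -/
lemma val_sub_eq_ite {n : ℕ} [NeZero n] (c p q : ZMod n) :
    (p - q).val = if (q - c).val ≤ (p - c).val then (p - c).val - (q - c).val
      else (p - c).val + n - (q - c).val := by
  have h : p - q = (p - c) - (q - c) := by ring
  rw [h]
  generalize p - c = s
  generalize q - c = t
  have hs := s.val_lt
  have ht := t.val_lt
  split_ifs with hle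
  · exact ZMod.val_sub hle
  · have hadd := ZMod.val_add (s - t) t
    have hd := (s - t).val_lt
    rw [sub_add_cancel] at hadd
    rcases lt_or_ge ((s - t).val + t.val) n with hlt | hge
    · rw [Nat.mod_eq_of_lt hlt] at hadd
      omega
    · rw [Nat.mod_eq_sub_mod hge, Nat.mod_eq_of_lt (by omega)] at hadd
      omega

lemma val_add_one_sub_eq_ite {n : ℕ} [NeZero n] (hn : 2 ≤ n) (c p : ZMod n) :
    (p + 1 - c).val = if (p - c).val + 1 = n then 0 else (p - c).val + 1 := by
  have : Fact (1 < n) := ⟨hn⟩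
  have h : p + 1 - c = (p - c) + 1 := by ring
  have hlt := (p - c).val_lt
  rw [h, ZMod.val_add, ZMod.val_one]
  split_ifs with he
  · rw [he, Nat.mod_self]
  · exact Nat.mod_eq_of_lt (by omega)

lemma val_sub_one_sub_eq_ite {n : ℕ} [NeZero n] (hn : 2 ≤ n) (c p : ZMod n) :
    (p - 1 - c).val = if (p - c).val = 0 then n - 1 else (p - c).val - 1 := by
  have h := val_add_one_sub_eq_ite hn c (p - 1)
  have hlt := (p - 1 - c).val_lt
  rw [sub_add_cancel] at h
  split_ifs at h ⊢ <;> omega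

lemma eq_iff_val_sub_eq {n : ℕ} [NeZero n] (c p q : ZMod n) :
    p = q ↔ (p - c).val = (q - c).val := by
  rw [(ZMod.val_injective n).eq_iff, sub_left_inj]

/-- Membership in a closed boundary interval, in terms of the distances to a base point. -/
lemma memCC_iff {n : ℕ} [NeZero n] (c x u v : ZMod n) :
    memCC x u v ↔ if (u - c).val ≤ (v - c).val
      then (u - c).val ≤ (x - c).val ∧ (x - c).val ≤ (v - c).val
      else (u - c).val ≤ (x - c).val ∨ (x - c).val ≤ (v - c).val := by
  have hx := (x - c).val_lt
  have hu := (u - c).val_lt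
  have hv := (v - c).val_lt
  rw [memCC, val_sub_eq_ite c x u, val_sub_eq_ite c v u]
  split_ifs <;> omega

lemma two_le_val_sub {n : ℕ} (M : TaggedEdge n) (h : M.a ≠ M.b) : 2 ≤ (M.b - M.a).val := by
  have h3 := M.three_le
  rw [deltaLen, if_neg h] at h3
  omega

/-- The crossing number is symmetric: `e(M,N) = e(N,M)`. -/
theorem crossNum_symm (n : ℕ) (hn : 3 ≤ n) (M N : TaggedEdge n) :
    crossNum M N = crossNum N M := by
  have : NeZero n := ⟨by omega⟩
  by_cases hM : M.a = M.b
  · by_cases hN : N.a = N.b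
    · simp [crossNum, hM, hN, ne_comm]
    · simp [crossNum, hM, hN]
  · by_cases hN : N.a = N.b
    · simp [crossNum, hM, hN]
    · have hM2 := two_le_val_sub M hM
      have hN2 := two_le_val_sub N hN
      rw [val_sub_eq_ite M.a N.b N.a] at hN2
      have hb := (M.b - M.a).val_lt
      have hx := (N.a - M.a).val_lt
      have hy := (N.b - M.a).val_lt
      have hn2 : 2 ≤ n := by omega
      unfold crossNum
      rw [if_neg hM, if_neg hN, if_neg hN, if_neg hM]
      simp only [memOO, memCC_iff M.a, ne_eq, eq_iff_val_sub_eq M.a,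
        val_add_one_sub_eq_ite hn2, val_sub_one_sub_eq_ite hn2, sub_self, ZMod.val_zero]
      clear hM hN
      generalize (M.b - M.a).val = b at *
      generalize (N.a - M.a).val = x at *
      generalize (N.b - M.a).val = y at *
      refine if_congr ?_ rfl (if_congr ?_ rfl rfl)
      · grind
      · grind (splits := 40)
end
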